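/- arXiv:2102.00350 — 5 statements merged into one kernel-verified Lean document; each statement's English description precedes it below -/
import Mathlib

section
/- Let n ≥ 3 be an integer, N = 2n/(n−2) and β > 0. Let φ: [0,∞) → (0,∞) be continuous and bounded and τ: [0,∞) → ℝ be of class C¹ with |τ'(s)| ≤ C(1+s)^{−β−1}. Define W: ℝⁿ∖{0} → ℝⁿ by W_i(x) = −(x_i/(2|x|ⁿ)) ∫₀^{|x|} s^{n−1} ( ∫_s^{+∞} φ(s₁)^N τ'(s₁) ds₁ ) ds. Then W is C² on ℝⁿ∖{0} and for every x ≠ 0: (i) ∑_j ∂_j W_j(x) = −(1/2) ∫_{|x|}^{+∞} φ(s)^N τ'(s) ds; (ii) ΔW_i(x) + ((n−2)/n) ∂_i(∑_j ∂_j W_j)(x) = ((n−1)/n) φ(|x|)^N ∂_i(τ(|x|)) for each i; (iii) (LW)_{ij}(x) = −( δ_{ij}/(n|x|ⁿ) − x_i x_j/|x|^{n+2} ) ∫₀^{|x|} sⁿ φ(s)^N τ'(s) ds; (iv) |LW|(x) = √((n−1)/n) · |x|^{−n} · | ∫₀^{|x|} sⁿ φ(s)^N τ'(s) ds |. -/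
open scoped BigOperators
open Real Filter MeasureTheory

noncomputable section

/-- Partial derivative `∂ᵢ f (x)` on Euclidean space. -/
def pd {n : ℕ} (f : EuclideanSpace ℝ (Fin n) → ℝ) (i : Fin n)
    (x : EuclideanSpace ℝ (Fin n)) : ℝ :=
  fderiv ℝ f x (EuclideanSpace.single i 1)

/-- Euclidean Laplacian `Δ f (x) = ∑ i, ∂ᵢ∂ᵢ f (x)`. -/
def lap {n : ℕ} (f : EuclideanSpace ℝ (Fin n) → ℝ)
    (x : EuclideanSpace ℝ (Fin n)) : ℝ :=
  ∑ i, pd (pd f i) i x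

/-- Conformal Killing operator
`(LW)_{ij} = ∂ᵢ W_j + ∂_j W_i − (2 δ_{ij}/n) ∑ₖ ∂ₖ Wₖ`. -/
def cK {n : ℕ} (W : Fin n → EuclideanSpace ℝ (Fin n) → ℝ) (i j : Fin n)
    (x : EuclideanSpace ℝ (Fin n)) : ℝ :=
  pd (W j) i x + pd (W i) j x
    - (2 / (n : ℝ)) * (if i = j then (1 : ℝ) else 0) * ∑ k, pd (W k) k x

/-- The critical exponent `N = 2n/(n−2)`. -/
def Nc (n : ℕ) : ℝ := 2 * n / ((n : ℝ) - 2)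

/-- The vacuum Einstein conformal constraint equations on `ℝⁿ` (flat background,
`σ ≡ 0`): the Lichnerowicz equation together with the vector equations. -/
def SolvesCCE (n : ℕ) (φ τ : EuclideanSpace ℝ (Fin n) → ℝ)
    (W : Fin n → EuclideanSpace ℝ (Fin n) → ℝ) : Prop :=
  (∀ x, -(4 * ((n : ℝ) - 1) / ((n : ℝ) - 2)) * lap φ x
      + (((n : ℝ) - 1) / (n : ℝ)) * (τ x) ^ 2 * (φ x) ^ (Nc n - 1)
      = (∑ i, ∑ j, (cK W i j x) ^ 2) * (φ x) ^ (-(Nc n) - 1)) ∧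
  (∀ i, ∀ x, lap (W i) x
      + (((n : ℝ) - 2) / (n : ℝ)) * pd (fun y => ∑ j, pd (W j) j y) i x
      = (((n : ℝ) - 1) / (n : ℝ)) * (φ x) ^ (Nc n) * pd τ i x)

/-- The second fundamental form `k_{ij} = (τ/n) φ^{N−2} δ_{ij} + φ^{−2} (LW)_{ij}`
produced by the conformal method. -/
def kTen (n : ℕ) (φ τ : EuclideanSpace ℝ (Fin n) → ℝ)
    (W : Fin n → EuclideanSpace ℝ (Fin n) → ℝ) (i j : Fin n)
    (x : EuclideanSpace ℝ (Fin n)) : ℝ :=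
  (τ x / (n : ℝ)) * (φ x) ^ (Nc n - 2) * (if i = j then (1 : ℝ) else 0)
    + (φ x) ^ (-2 : ℝ) * cK W i j x

/-- The explicit radial vector field
`W_i(x) = −(x_i/(2|x|ⁿ)) ∫₀^{|x|} s^{n−1} ( ∫_s^{∞} φ(s₁)^N τ'(s₁) ds₁ ) ds`. -/
def Wrad (n : ℕ) (φ τ : ℝ → ℝ) (i : Fin n) (x : EuclideanSpace ℝ (Fin n)) : ℝ :=
  -(x i / (2 * ‖x‖ ^ n)) *
    ∫ s in (0 : ℝ)..‖x‖, s ^ (n - 1) * ∫ s₁ in Set.Ioi s, φ s₁ ^ (Nc n) * deriv τ s₁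

section Radial

variable {n : ℕ}

lemma pd_eq {F : EuclideanSpace ℝ (Fin n) → ℝ} {F' : EuclideanSpace ℝ (Fin n) →L[ℝ] ℝ}
    {x : EuclideanSpace ℝ (Fin n)} (h : HasFDerivAt F F' x) (i : Fin n) :
    pd F i x = F' (EuclideanSpace.single i 1) := by
  rw [pd, h.fderiv]

lemma pd_congr {F G : EuclideanSpace ℝ (Fin n) → ℝ} {x : EuclideanSpace ℝ (Fin n)}
    (hx : x ≠ 0) (h : ∀ y, y ≠ 0 → F y = G y) (i : Fin n) : pd F i x = pd G i x := by
  have hFG : F =ᶠ[nhds x] G := by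
    filter_upwards [isOpen_ne.mem_nhds hx] with y hy using h y hy
  rw [pd, pd, hFG.fderiv_eq]

lemma hasFDerivAt_comp_norm {f : ℝ → ℝ} {f' : ℝ} {x : EuclideanSpace ℝ (Fin n)} (hx : x ≠ 0)
    (hf : HasDerivAt f f' ‖x‖) :
    HasFDerivAt (fun y : EuclideanSpace ℝ (Fin n) => f ‖y‖) ((f' / ‖x‖) • innerSL ℝ x) x := by
  have hpos : 0 < ‖x‖ := norm_pos_iff.2 hx
  have h := (hasStrictFDerivAt_norm_sq x).hasFDerivAt.sqrt (pow_pos hpos 2).ne'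
  simp only [Real.sqrt_sq (norm_nonneg _)] at h
  have h' := hf.comp_hasFDerivAt x h
  refine h'.congr_fderiv ?_
  ext y
  simp
  field_simp

lemma pd_comp_norm {f : ℝ → ℝ} {f' : ℝ} {x : EuclideanSpace ℝ (Fin n)} (hx : x ≠ 0)
    (hf : HasDerivAt f f' ‖x‖) (i : Fin n) :
    pd (fun y => f ‖y‖) i x = f' / ‖x‖ * x i := by
  rw [pd_eq (hasFDerivAt_comp_norm hx hf)]
  simp [EuclideanSpace.inner_single_right]

lemma hasFDerivAt_coord (i : Fin n) (x : EuclideanSpace ℝ (Fin n)) :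
    HasFDerivAt (fun y : EuclideanSpace ℝ (Fin n) => y i) (EuclideanSpace.proj (𝕜 := ℝ) i) x :=
  (EuclideanSpace.proj (𝕜 := ℝ) i).hasFDerivAt

lemma pd_coord_mul_comp_norm {f : ℝ → ℝ} {f' : ℝ} {x : EuclideanSpace ℝ (Fin n)} (hx : x ≠ 0)
    (hf : HasDerivAt f f' ‖x‖) (i j : Fin n) :
    pd (fun y => y i * f ‖y‖) j x
      = (if i = j then 1 else 0) * f ‖x‖ + x i * x j * (f' / ‖x‖) := by
  have h : HasFDerivAt (fun y : EuclideanSpace ℝ (Fin n) => y i * f ‖y‖) _ x :=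
    (hasFDerivAt_coord i x).mul (hasFDerivAt_comp_norm hx hf)
  rw [pd_eq h]
  simp [EuclideanSpace.inner_single_right, PiLp.single_apply]
  ring

lemma pd_delta_add_coord_mul_coord {f g : ℝ → ℝ} {f' g' : ℝ} {x : EuclideanSpace ℝ (Fin n)}
    (hx : x ≠ 0) (hf : HasDerivAt f f' ‖x‖) (hg : HasDerivAt g g' ‖x‖) (c : ℝ) (i j k : Fin n) :
    pd (fun y => c * f ‖y‖ + y i * y j * g ‖y‖) k x
      = c * (f' / ‖x‖ * x k) + ((if i = k then 1 else 0) * x j + (if j = k then 1 else 0) * x i)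
          * g ‖x‖ + x i * x j * (g' / ‖x‖ * x k) := by
  have h : HasFDerivAt
      (fun y : EuclideanSpace ℝ (Fin n) => c * f ‖y‖ + y i * y j * g ‖y‖) _ x :=
    ((hasFDerivAt_comp_norm hx hf).const_mul c).add
      (((hasFDerivAt_coord i x).mul (hasFDerivAt_coord j x)).mul (hasFDerivAt_comp_norm hx hg))
  rw [pd_eq h]
  simp [EuclideanSpace.inner_single_right, PiLp.single_apply]
  split_ifs <;> ring

lemma norm_sq_eq_sum_mul_self (x : EuclideanSpace ℝ (Fin n)) : ∑ i, x i * x i = ‖x‖ ^ 2 := by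
  rw [EuclideanSpace.real_norm_sq_eq]
  simp only [sq]

/-- The vector field `xᵢ f(|x|)`, with `f` solving `r f' + n f = -H/2` and `H' = -ψ`, has
divergence `-H/2` and Laplacian `xᵢ ψ / (2r)`. -/
lemma radial_field_identities (f H ψ : ℝ → ℝ)
    (hf : ∀ r, 0 < r → HasDerivAt f (-(H r / 2 + n * f r) / r) r)
    (hH : ∀ r, 0 < r → HasDerivAt H (-ψ r) r) {x : EuclideanSpace ℝ (Fin n)} (hx : x ≠ 0) :
    (∀ i j, pd (fun y => y i * f ‖y‖) j x = (if i = j then 1 else 0) * f ‖x‖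
        + x i * x j * (-(H ‖x‖ / 2 + n * f ‖x‖) / ‖x‖ ^ 2)) ∧
    (∑ j, pd (fun y => y j * f ‖y‖) j x = -(1 / 2) * H ‖x‖) ∧
    (∀ i, lap (fun y => y i * f ‖y‖) x = x i * ψ ‖x‖ / (2 * ‖x‖)) := by
  have hpd : ∀ y : EuclideanSpace ℝ (Fin n), y ≠ 0 → ∀ i j,
      pd (fun y => y i * f ‖y‖) j y = (if i = j then 1 else 0) * f ‖y‖
        + y i * y j * (-(H ‖y‖ / 2 + n * f ‖y‖) / ‖y‖ ^ 2) := by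
    intro y hy i j
    rw [pd_coord_mul_comp_norm hy (hf _ (norm_pos_iff.2 hy)), div_div, sq]
  have hr : 0 < ‖x‖ := norm_pos_iff.2 hx
  refine ⟨hpd x hx, ?_, fun i => ?_⟩
  · simp only [hpd x hx, Finset.sum_add_distrib, ← Finset.sum_mul, norm_sq_eq_sum_mul_self]
    simp
    field_simp
    ring
  · have hg : HasDerivAt (fun r => -(H r / 2 + n * f r) / r ^ 2)
        ((ψ ‖x‖ / (2 * ‖x‖) + (n + 2) * ((H ‖x‖ / 2 + n * f ‖x‖) / ‖x‖ ^ 2)) / ‖x‖) ‖x‖ := by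
      have h := ((((hH _ hr).div_const 2).add ((hf _ hr).const_mul (n : ℝ))).neg).div
        (hasDerivAt_pow 2 ‖x‖) (pow_pos hr 2).ne'
      refine h.congr_deriv ?_
      simp
      field_simp
      ring
    have hterm : ∀ j, pd (pd (fun y => y i * f ‖y‖) j) j x = _ := fun j =>
      (pd_congr hx (fun y hy => hpd y hy i j) j).trans
        (pd_delta_add_coord_mul_coord hx (hf _ hr) hg _ i j j)
    simp only [lap, hterm, if_true]
    have hsum : ∀ a b c : ℝ, ∑ j, ((if i = j then (1 : ℝ) else 0) * (a * x j)
          + ((if i = j then 1 else 0) * x j + 1 * x i) * b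
          + x i * x j * (c * x j)) = x i * a + (1 + n) * x i * b + x i * c * ‖x‖ ^ 2 := by
      intro a b c
      have h : ∀ j, (if i = j then (1 : ℝ) else 0) * (a * x j)
          + ((if i = j then 1 else 0) * x j + 1 * x i) * b + x i * x j * (c * x j)
          = (if i = j then (a + b) * x j else 0) + x i * b + x i * c * (x j * x j) := by
        intro j
        split_ifs <;> ring
      simp only [h, Finset.sum_add_distrib, ← Finset.mul_sum, norm_sq_eq_sum_mul_self,
        Finset.sum_ite_eq, Finset.mem_univ, if_true, Finset.sum_const, Finset.card_univ,
        Fintype.card_fin, nsmul_eq_mul]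
      ring
    rw [hsum]
    field_simp
    ring

lemma sum_sq_traceless (hn : (n : ℝ) ≠ 0) (x : EuclideanSpace ℝ (Fin n)) :
    ∑ i, ∑ j, (x i * x j - (if i = j then 1 else 0) * (‖x‖ ^ 2 / n)) ^ 2
      = ((n : ℝ) - 1) / n * (‖x‖ ^ 2) ^ 2 := by
  set t := ‖x‖ ^ 2 with ht
  have h : ∀ i j, (x i * x j - (if i = j then 1 else 0) * (t / n)) ^ 2
      = (x i * x i) * (x j * x j)
        + (if i = j then (t / n) ^ 2 - 2 * (t / n) * (x i * x i) else 0) := by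
    intro i j
    split_ifs with hij
    · subst hij; ring
    · ring
  simp only [h, Finset.sum_add_distrib, ← Finset.mul_sum, ← Finset.sum_mul,
    norm_sq_eq_sum_mul_self, Finset.sum_ite_eq, Finset.mem_univ, if_true,
    Finset.sum_sub_distrib, Finset.sum_const, Finset.card_univ, Fintype.card_fin, ← ht]
  simp
  field_simp
  ring

end Radial

section Profile

lemma hasDerivAt_sub_integral {ψ : ℝ → ℝ} (hψ : Continuous ψ) (c s : ℝ) :
    HasDerivAt (fun s => c - ∫ t in (0 : ℝ)..s, ψ t) (-ψ s) s :=
  (intervalIntegral.integral_hasDerivAt_right (hψ.intervalIntegrable _ _)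
    (hψ.stronglyMeasurableAtFilter _ _) hψ.continuousAt).const_sub c

lemma hasDerivAt_integral {g : ℝ → ℝ} (hg : Continuous g) (s : ℝ) :
    HasDerivAt (fun s => ∫ t in (0 : ℝ)..s, g t) (g s) s :=
  intervalIntegral.integral_hasDerivAt_right (hg.intervalIntegrable _ _)
    (hg.stronglyMeasurableAtFilter _ _) hg.continuousAt

lemma contDiff_two_integral_pow_mul {H ψ : ℝ → ℝ} (hψ : Continuous ψ)
    (hH : ∀ s, HasDerivAt H (-ψ s) s) (m : ℕ) :
    ContDiff ℝ 2 (fun r => ∫ s in (0 : ℝ)..r, s ^ m * H s) := by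
  have hH1 : ContDiff ℝ 1 H := by
    rw [contDiff_one_iff_deriv]
    refine ⟨fun s => (hH s).differentiableAt, ?_⟩
    rw [funext fun s => (hH s).deriv]
    exact hψ.neg
  have hg : ContDiff ℝ 1 (fun s : ℝ => s ^ m * H s) := (contDiff_id.pow m).mul hH1
  rw [show (2 : WithTop ℕ∞) = 1 + 1 by norm_num, contDiff_succ_iff_deriv]
  refine ⟨fun s => (hasDerivAt_integral hg.continuous s).differentiableAt, by simp, ?_⟩
  rw [funext fun s => (hasDerivAt_integral hg.continuous s).deriv]
  exact hg

/-- Integration by parts for the radial profile. -/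
lemma integral_pow_mul_eq {H ψ : ℝ → ℝ} (hψ : Continuous ψ)
    (hH : ∀ s, HasDerivAt H (-ψ s) s) {n : ℕ} (hn : n ≠ 0) (r : ℝ) :
    ∫ s in (0 : ℝ)..r, s ^ n * ψ s
      = n * (∫ s in (0 : ℝ)..r, s ^ (n - 1) * H s) - r ^ n * H r := by
  have hHc : Continuous H := continuous_iff_continuousAt.2 fun s => (hH s).continuousAt
  have hd : ∀ s, HasDerivAt
      (fun r => n * (∫ s in (0 : ℝ)..r, s ^ (n - 1) * H s) - r ^ n * H r) (s ^ n * ψ s) s := by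
    intro s
    have h := ((hasDerivAt_integral ((continuous_id.pow (n - 1)).mul hHc) s).const_mul
      (n : ℝ)).sub ((hasDerivAt_pow n s).mul (hH s))
    refine h.congr_deriv ?_
    simp
    ring
  rw [intervalIntegral.integral_eq_sub_of_hasDerivAt (fun s _ => hd s)
    (((continuous_id.pow n).mul hψ).intervalIntegrable _ _)]
  simp [hn]

lemma hasDerivAt_profile {H ψ : ℝ → ℝ}
    (hH : ∀ s, HasDerivAt H (-ψ s) s) {n : ℕ} (hn : n ≠ 0) {r : ℝ} (hr : 0 < r) :
    HasDerivAt (fun r => -(∫ s in (0 : ℝ)..r, s ^ (n - 1) * H s) / (2 * r ^ n))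
      (-(H r / 2 + n * (-(∫ s in (0 : ℝ)..r, s ^ (n - 1) * H s) / (2 * r ^ n))) / r) r := by
  have hHc : Continuous H := continuous_iff_continuousAt.2 fun s => (hH s).continuousAt
  have hc : Continuous fun s : ℝ => s ^ (n - 1) * H s := by fun_prop
  have h := (hasDerivAt_integral hc r).fun_neg.fun_div
    ((hasDerivAt_pow n r).const_mul 2) (by positivity)
  refine h.congr_deriv ?_
  obtain ⟨m, rfl⟩ := Nat.exists_eq_succ_of_ne_zero hn
  simp only [Nat.succ_eq_add_one, Nat.add_sub_cancel]
  field_simp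
  ring

lemma integrableOn_rpow_mul_of_decay {φ h : ℝ → ℝ} {β C N : ℝ} (hβ : 0 < β) (hN : 0 ≤ N)
    (hφpos : ∀ s : ℝ, 0 ≤ s → 0 < φ s) (hφbdd : ∃ M : ℝ, ∀ s : ℝ, 0 ≤ s → |φ s| ≤ M)
    (hh : ∀ s : ℝ, 0 ≤ s → |h s| ≤ C * (1 + s) ^ (-β - 1))
    (hcont : ContinuousOn (fun s => φ s ^ N * h s) (Set.Ici 0)) :
    IntegrableOn (fun s => φ s ^ N * h s) (Set.Ioi 0) := by
  obtain ⟨M, hM⟩ := hφbdd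
  have hint : IntegrableOn (fun s : ℝ => M ^ N * (C * (s + 1) ^ (-β - 1))) (Set.Ioi 0) :=
    ((integrableOn_add_rpow_Ioi_of_lt (by linarith) (by norm_num)).const_mul C).const_mul _
  refine Integrable.mono' hint
    ((hcont.mono Set.Ioi_subset_Ici_self).aestronglyMeasurable measurableSet_Ioi) ?_
  filter_upwards [ae_restrict_mem measurableSet_Ioi] with s hs
  have hs0 : 0 ≤ s := le_of_lt hs
  have h1 : φ s ^ N ≤ M ^ N :=
    Real.rpow_le_rpow (hφpos s hs0).le ((le_abs_self _).trans (hM s hs0)) hN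
  have h0 : 0 ≤ φ s ^ N := Real.rpow_nonneg (hφpos s hs0).le _
  rw [norm_mul, Real.norm_of_nonneg h0, Real.norm_eq_abs, add_comm s 1]
  exact mul_le_mul h1 (hh s hs0) (abs_nonneg _) (h0.trans h1)

end Profile

/-- Solution of the vector equations: the explicit radial vector
field `W` is `C²` away from the origin, its divergence, the vector equations,
`(LW)_{ij}` and `|LW|` are given by the stated explicit formulas. -/
theorem stmt2 (n : ℕ) (hn : 3 ≤ n) (β C : ℝ) (hβ : 0 < β) (hC : 0 < C)
    (φ τ : ℝ → ℝ)
    (hφcont : ContinuousOn φ (Set.Ici (0 : ℝ)))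
    (hφpos : ∀ s : ℝ, 0 ≤ s → 0 < φ s)
    (hφbdd : ∃ M : ℝ, ∀ s : ℝ, 0 ≤ s → |φ s| ≤ M)
    (hτreg : ContDiff ℝ 1 τ)
    (hτ' : ∀ s : ℝ, 0 ≤ s → |deriv τ s| ≤ C * (1 + s) ^ (-β - 1)) :
    (∀ i, ContDiffOn ℝ 2 (Wrad n φ τ i) {x : EuclideanSpace ℝ (Fin n) | x ≠ 0}) ∧
    ∀ x : EuclideanSpace ℝ (Fin n), x ≠ 0 →
      -- (i) divergence of W
      ((∑ j, pd (Wrad n φ τ j) j x)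
          = -(1 / 2) * ∫ s in Set.Ioi ‖x‖, φ s ^ (Nc n) * deriv τ s) ∧
      -- (ii) the vector equations
      (∀ i, lap (Wrad n φ τ i) x
          + (((n : ℝ) - 2) / (n : ℝ)) * pd (fun y => ∑ j, pd (Wrad n φ τ j) j y) i x
          = (((n : ℝ) - 1) / (n : ℝ)) * φ ‖x‖ ^ (Nc n) * pd (fun y => τ ‖y‖) i x) ∧
      -- (iii) the conformal Killing tensor of W
      (∀ i j, cK (Wrad n φ τ) i j x
          = -((if i = j then (1 : ℝ) else 0) / ((n : ℝ) * ‖x‖ ^ n)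
              - x i * x j / ‖x‖ ^ (n + 2)) *
            ∫ s in (0 : ℝ)..‖x‖, s ^ n * φ s ^ (Nc n) * deriv τ s) ∧
      -- (iv) the norm |LW|
      (Real.sqrt (∑ i, ∑ j, (cK (Wrad n φ τ) i j x) ^ 2)
          = Real.sqrt (((n : ℝ) - 1) / (n : ℝ)) / ‖x‖ ^ n *
            |∫ s in (0 : ℝ)..‖x‖, s ^ n * φ s ^ (Nc n) * deriv τ s|) := by
  have hn0 : n ≠ 0 := by omega
  have hnR : (n : ℝ) ≠ 0 := by exact_mod_cast hn0
  have hn3 : (3 : ℝ) ≤ n := by exact_mod_cast hn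
  have hN : 0 ≤ Nc n := div_nonneg (by positivity) (by linarith)
  set ψ : ℝ → ℝ := fun s => φ (max s 0) ^ Nc n * deriv τ s with hψdef
  have hψ : Continuous ψ := by
    refine Continuous.mul (Continuous.rpow_const ?_ fun _ => Or.inr hN)
      (hτreg.continuous_deriv le_rfl)
    exact hφcont.comp_continuous (continuous_id.max continuous_const) fun s => le_max_right s 0
  have hψeq : ∀ s, 0 ≤ s → φ s ^ Nc n * deriv τ s = ψ s := fun s hs => by
    simp [hψdef, max_eq_left hs]
  have hint : IntegrableOn ψ (Set.Ioi 0) :=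
    (integrableOn_rpow_mul_of_decay hβ hN hφpos hφbdd hτ'
      (hψ.continuousOn.congr hψeq)).congr_fun
        (fun s hs => hψeq s (le_of_lt hs)) measurableSet_Ioi
  set H : ℝ → ℝ := fun s => (∫ t in Set.Ioi 0, ψ t) - ∫ t in (0 : ℝ)..s, ψ t with hHdef
  have hH : ∀ s, HasDerivAt H (-ψ s) s := hasDerivAt_sub_integral hψ _
  have hHeq : ∀ s, 0 ≤ s → ∫ t in Set.Ioi s, φ t ^ Nc n * deriv τ t = H s := by
    intro s hs
    rw [setIntegral_congr_fun measurableSet_Ioi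
      (fun t ht => hψeq t (hs.trans (le_of_lt ht))), hHdef]
    have h := intervalIntegral.integral_interval_add_Ioi hint
      (hint.mono_set (Set.Ioi_subset_Ioi hs))
    linarith
  set f : ℝ → ℝ := fun r => -(∫ s in (0 : ℝ)..r, s ^ (n - 1) * H s) / (2 * r ^ n) with hfdef
  have hf : ∀ r, 0 < r → HasDerivAt f (-(H r / 2 + n * f r) / r) r :=
    fun r hr => hasDerivAt_profile hH hn0 hr
  have hW : ∀ i, Wrad n φ τ i = fun y => y i * f ‖y‖ := by
    intro i
    funext y
    have h : ∫ s in (0 : ℝ)..‖y‖, s ^ (n - 1) * ∫ s₁ in Set.Ioi s, φ s₁ ^ Nc n * deriv τ s₁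
        = ∫ s in (0 : ℝ)..‖y‖, s ^ (n - 1) * H s := by
      refine intervalIntegral.integral_congr fun s hs => ?_
      rw [Set.uIcc_of_le (norm_nonneg y)] at hs
      simp only [hHeq s hs.1]
    rw [Wrad, h, hfdef]
    ring
  refine ⟨fun i => ?_, fun x hx => ?_⟩
  · rw [hW]
    intro x hx
    have hr : 0 < ‖x‖ := norm_pos_iff.2 hx
    have hf2 : ContDiffAt ℝ 2 f ‖x‖ :=
      (contDiff_two_integral_pow_mul hψ hH (n - 1)).contDiffAt.neg.div
        (contDiffAt_const.mul (contDiffAt_id.pow n)) (by positivity)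
    exact ((EuclideanSpace.proj (𝕜 := ℝ) i).contDiff.contDiffAt.mul
      (hf2.comp x (contDiffAt_norm ℝ hx))).contDiffWithinAt
  have hr : 0 < ‖x‖ := norm_pos_iff.2 hx
  have hid := fun y (hy : y ≠ 0) => radial_field_identities (n := n) f H ψ hf
    (fun r _ => hH r) (x := y) hy
  obtain ⟨hpd, hdiv, hlap⟩ := hid x hx
  have hK : ∫ s in (0 : ℝ)..‖x‖, s ^ n * φ s ^ Nc n * deriv τ s
      = -(2 * ‖x‖ ^ n) * (H ‖x‖ / 2 + n * f ‖x‖) := by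
    have h : ∫ s in (0 : ℝ)..‖x‖, s ^ n * φ s ^ Nc n * deriv τ s
        = ∫ s in (0 : ℝ)..‖x‖, s ^ n * ψ s := by
      refine intervalIntegral.integral_congr fun s hs => ?_
      rw [Set.uIcc_of_le (norm_nonneg x)] at hs
      simp only [mul_assoc, hψeq s hs.1]
    rw [h, integral_pow_mul_eq hψ hH hn0, hfdef]
    field_simp
    ring
  have hcK : ∀ i j, cK (Wrad n φ τ) i j x
      = (x i * x j - (if i = j then 1 else 0) * (‖x‖ ^ 2 / n)) *
        ((∫ s in (0 : ℝ)..‖x‖, s ^ n * φ s ^ Nc n * deriv τ s) / ‖x‖ ^ (n + 2)) := by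
    intro i j
    simp only [cK, hW]
    rw [hdiv]
    simp only [hpd, hK, pow_add, @eq_comm _ j i]
    field_simp
    ring
  refine ⟨?_, fun i => ?_, fun i j => ?_, ?_⟩
  · simp only [hW, hdiv, hHeq _ hr.le]
  · have hgrad : pd (fun y => ∑ j, pd (Wrad n φ τ j) j y) i x = ψ ‖x‖ / 2 / ‖x‖ * x i := by
      simp only [hW]
      rw [pd_congr hx (fun y hy => (hid y hy).2.1) i,
        pd_comp_norm (f := fun r => -(1 / 2) * H r) hx ((hH ‖x‖).const_mul _)]
      ring
    have hτd : HasDerivAt τ (deriv τ ‖x‖) ‖x‖ :=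
      ((hτreg.differentiable one_ne_zero) _).hasDerivAt
    rw [hgrad, hW, hlap, pd_comp_norm hx hτd, ← hψeq _ hr.le]
    field_simp
    ring
  · rw [hcK, pow_add]
    field_simp
    ring
  · simp only [hcK, mul_pow (_ - _ : ℝ), ← Finset.sum_mul]
    rw [sum_sq_traceless hnR, pow_add ‖x‖ n 2]
    set K := ∫ s in (0 : ℝ)..‖x‖, s ^ n * φ s ^ Nc n * deriv τ s
    have hsq : ((n : ℝ) - 1) / n * (‖x‖ ^ 2) ^ 2 * (K / (‖x‖ ^ n * ‖x‖ ^ 2)) ^ 2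
        = ((n : ℝ) - 1) / n * (K / ‖x‖ ^ n) ^ 2 := by
      field_simp
    rw [hsq, Real.sqrt_mul (div_nonneg (by linarith) (by linarith)), Real.sqrt_sq_eq_abs, abs_div,
      abs_of_pos (pow_pos hr n)]
    ring
end
end

section
/- Let n ≥ 3 be an integer and N = 2n/(n−2). Let φ: [0,∞) → (0,∞) be of class C² with φ'(r) ≥ 0 for all r ≥ 0, and let τ: [0,∞) → ℝ be of class C¹. Then the reduced Lichnerowicz ODE, −(4n/(n−2))(φ''(r) + (n−1)φ'(r)/r) + τ(r)² φ(r)^{N−1} = r^{−2n} ( ∫₀^r sⁿ φ(s)^N τ'(s) ds )² φ(r)^{−N−1}, holds for all r > 0 if and only if for all r > 0 one has ( ∫₀^r (sⁿ φ(s)^N)'(s) τ(s) ds )² = 2N rⁿ φ(r)^N ∫₀^r ( (sⁿ φ(s)^N)'(s) / φ(s)^{N−1} ) ( φ''(s) + (n−1)φ'(s)/s ) ds. -/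
open scoped BigOperators
open Real Filter MeasureTheory

noncomputable section

theorem exists_continuous_eqOn_Ici {f : ℝ → ℝ} (hf : ContinuousOn f (Set.Ici 0)) :
    ∃ h : ℝ → ℝ, Continuous h ∧
      ∀ r : ℝ, 0 ≤ r → f r = h r ∧ ∫ s in (0 : ℝ)..r, f s = ∫ s in (0 : ℝ)..r, h s := by
  refine ⟨fun s => f (max s 0), ?_, fun r hr => ⟨by simp [hr], ?_⟩⟩
  · exact hf.comp_continuous (by fun_prop) fun s => le_max_right s 0
  · refine intervalIntegral.integral_congr fun s hs => ?_
    rw [Set.uIcc_of_le hr] at hs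
    simp [hs.1]

theorem hasDerivAt_integral_of_continuousOn_Ici {f : ℝ → ℝ} (hf : ContinuousOn f (Set.Ici 0))
    {r : ℝ} (hr : 0 < r) : HasDerivAt (fun u => ∫ s in (0 : ℝ)..u, f s) (f r) r := by
  obtain ⟨h, hc, heq⟩ := exists_continuous_eqOn_Ici hf
  rw [(heq r hr.le).1]
  refine (hc.integral_hasStrictDerivAt 0 r).hasDerivAt.congr_of_eventuallyEq ?_
  filter_upwards [lt_mem_nhds hr] with u hu using (heq u hu.le).2

theorem tendsto_integral_nhdsGT_zero {f : ℝ → ℝ} (hf : ContinuousOn f (Set.Ici 0)) :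
    Tendsto (fun u => ∫ s in (0 : ℝ)..u, f s) (nhdsWithin 0 (Set.Ioi 0)) (nhds 0) := by
  obtain ⟨h, hc, heq⟩ := exists_continuous_eqOn_Ici hf
  have h0 := (hc.integral_hasStrictDerivAt 0 0).hasDerivAt.continuousAt.tendsto
  simp only [intervalIntegral.integral_same] at h0
  refine (h0.mono_left nhdsWithin_le_nhds).congr' ?_
  filter_upwards [self_mem_nhdsWithin] with u hu using (heq u (le_of_lt hu)).2.symm

theorem forall_pos_eq_iff_forall_pos_deriv_eq {F K F' K' : ℝ → ℝ}
    (hF : ∀ r > 0, HasDerivAt F (F' r) r) (hK : ∀ r > 0, HasDerivAt K (K' r) r)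
    (hF0 : Tendsto F (nhdsWithin 0 (Set.Ioi 0)) (nhds 0))
    (hK0 : Tendsto K (nhdsWithin 0 (Set.Ioi 0)) (nhds 0)) :
    (∀ r > 0, F r = K r) ↔ ∀ r > 0, F' r = K' r := by
  constructor
  · intro h r hr
    refine (hF r hr).unique ((hK r hr).congr_of_eventuallyEq ?_)
    filter_upwards [lt_mem_nhds hr] with u hu using h u hu
  · intro h r hr
    have hd : ∀ u > 0, HasDerivAt (fun v => F v - K v) 0 u := fun u hu => by
      have := (hF u hu).sub (hK u hu)
      rwa [h u hu, sub_self] at this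
    have hconst : ∀ u > 0, F u - K u = F r - K r := fun u hu =>
      isOpen_Ioi.is_const_of_deriv_eq_zero isPreconnected_Ioi
        (fun v hv => (hd v hv).differentiableAt.differentiableWithinAt)
        (fun v hv => (hd v hv).deriv) hu hr
    have hlim : Tendsto (fun v => F v - K v) (nhdsWithin 0 (Set.Ioi 0)) (nhds (F r - K r)) := by
      refine tendsto_const_nhds.congr' ?_
      filter_upwards [self_mem_nhdsWithin] with u hu using (hconst u hu).symm
    have := tendsto_nhds_unique hlim (by simpa using hF0.sub hK0)
    linarith

/-- If `G` is the primitive of `g ≥ 0` vanishing at `0`, then `(∫₀ʳ g τ)² / G(r) → 0`. -/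
theorem tendsto_sq_integral_mul_div {G g τ : ℝ → ℝ} (hg : ContinuousOn g (Set.Ici 0))
    (hg0 : ∀ r, 0 ≤ r → 0 ≤ g r) (hG : ∀ r > 0, ∫ s in (0 : ℝ)..r, g s = G r)
    (hGpos : ∀ r > 0, 0 < G r) (hτ : Continuous τ) :
    Tendsto (fun r => (∫ s in (0 : ℝ)..r, g s * τ s) ^ 2 / G r)
      (nhdsWithin 0 (Set.Ioi 0)) (nhds 0) := by
  obtain ⟨M, hM⟩ := (isCompact_Icc (a := (0 : ℝ)) (b := 1)).exists_bound_of_continuousOn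
    hτ.continuousOn
  have hlim : Tendsto (fun r => M ^ 2 * ∫ s in (0 : ℝ)..r, g s)
      (nhdsWithin 0 (Set.Ioi 0)) (nhds 0) := by
    simpa using (tendsto_integral_nhdsGT_zero hg).const_mul (M ^ 2)
  refine squeeze_zero' ?_ ?_ hlim
  · filter_upwards [self_mem_nhdsWithin] with r hr
    have := hGpos r hr
    positivity
  · filter_upwards [Ioc_mem_nhdsGT (zero_lt_one' ℝ)] with r hr
    have hpos := hGpos r hr.1
    have hbound : |∫ s in (0 : ℝ)..r, g s * τ s| ≤ M * G r := by
      rw [← hG r hr.1, ← intervalIntegral.integral_const_mul]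
      rw [← Real.norm_eq_abs]
      refine intervalIntegral.norm_integral_le_of_norm_le hr.1.le
        (Eventually.of_forall fun s hs => ?_) ?_
      · rw [norm_mul, Real.norm_of_nonneg (hg0 s hs.1.le), mul_comm]
        exact mul_le_mul_of_nonneg_right (hM s ⟨hs.1.le, hs.2.trans hr.2⟩) (hg0 s hs.1.le)
      · refine (ContinuousOn.intervalIntegrable ?_).const_mul M
        rw [Set.uIcc_of_le hr.1.le]
        exact hg.mono Set.Icc_subset_Ici_self
    rw [hG r hr.1, div_le_iff₀ hpos]
    calc (∫ s in (0 : ℝ)..r, g s * τ s) ^ 2 = |∫ s in (0 : ℝ)..r, g s * τ s| ^ 2 :=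
          (sq_abs _).symm
      _ ≤ (M * G r) ^ 2 := pow_le_pow_left₀ (abs_nonneg _) hbound 2
      _ = M ^ 2 * G r * G r := by ring

theorem hasDerivAt_pow_mul_rpow {φ : ℝ → ℝ} (hφ : Differentiable ℝ φ) (n : ℕ) (p : ℝ) {s : ℝ}
    (hs : 0 < φ s) :
    HasDerivAt (fun t : ℝ => t ^ n * φ t ^ p)
      (n * s ^ (n - 1) * φ s ^ p + s ^ n * (deriv φ s * p * φ s ^ (p - 1))) s :=
  (hasDerivAt_pow n s).mul ((hφ s).hasDerivAt.rpow_const (Or.inl hs.ne'))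

theorem continuousOn_deriv_pow_mul_rpow {φ : ℝ → ℝ} (hφ : ContDiff ℝ 2 φ)
    (hφpos : ∀ r, 0 ≤ r → 0 < φ r) (n : ℕ) (p : ℝ) :
    ContinuousOn (deriv fun t : ℝ => t ^ n * φ t ^ p) (Set.Ici 0) := by
  have hφc := hφ.continuous
  have hφ'c : Continuous (deriv φ) := hφ.continuous_deriv (by norm_num)
  have hpow : ∀ q : ℝ, ContinuousOn (fun s => φ s ^ q) (Set.Ici 0) := fun q =>
    hφc.continuousOn.rpow_const fun s hs => Or.inl (hφpos s hs).ne'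
  have h1 := hpow p
  have h2 := hpow (p - 1)
  refine ContinuousOn.congr (f := fun s =>
    n * s ^ (n - 1) * φ s ^ p + s ^ n * (deriv φ s * p * φ s ^ (p - 1))) ?_ fun s hs =>
      (hasDerivAt_pow_mul_rpow (hφ.differentiable (by norm_num)) n p (hφpos s hs)).deriv
  fun_prop

/-- The singular factor `φ' / s` of the radial Laplacian is compensated by the vanishing of
`(sⁿ φᵖ)'` at the origin. -/
theorem continuousOn_deriv_mul_radial_laplacian {φ : ℝ → ℝ} (hφ : ContDiff ℝ 2 φ)
    (hφpos : ∀ r, 0 ≤ r → 0 < φ r) {n : ℕ} (hn : 3 ≤ n) (p : ℝ) :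
    ContinuousOn (fun s => (deriv (fun t : ℝ => t ^ n * φ t ^ p) s / φ s ^ (p - 1))
      * (deriv (deriv φ) s + ((n : ℝ) - 1) * deriv φ s / s)) (Set.Ici 0) := by
  have hφc := hφ.continuous
  have hφ'c : Continuous (deriv φ) := hφ.continuous_deriv (by norm_num)
  have hφ''c : Continuous (deriv (deriv φ)) := by
    have : ContDiff ℝ 1 (deriv φ) :=
      ContDiff.deriv' (n := 1) (by simpa [one_add_one_eq_two] using hφ)
    exact this.continuous_deriv le_rfl
  have hg := continuousOn_deriv_pow_mul_rpow hφ hφpos n p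
  have hpow : ∀ q : ℝ, ContinuousOn (fun s => φ s ^ q) (Set.Ici 0) := fun q =>
    hφc.continuousOn.rpow_const fun s hs => Or.inl (hφpos s hs).ne'
  have h1 := hpow p
  have h2 := hpow (p - 1)
  have hne : ∀ s ∈ Set.Ici (0 : ℝ), φ s ^ (p - 1) ≠ 0 := fun s hs =>
    (rpow_pos_of_pos (hφpos s hs) _).ne'
  refine ContinuousOn.congr (f := fun s =>
    deriv (fun t : ℝ => t ^ n * φ t ^ p) s / φ s ^ (p - 1) * deriv (deriv φ) s +
    (n * s ^ (n - 2) * φ s ^ p + s ^ (n - 1) * (deriv φ s * p * φ s ^ (p - 1))) / φ s ^ (p - 1)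
      * (((n : ℝ) - 1) * deriv φ s)) ?_ fun s hs => ?_
  · exact ((hg.div h2 hne).mul hφ''c.continuousOn).add
      (ContinuousOn.mul (ContinuousOn.div (by fun_prop) h2 hne) (by fun_prop))
  · simp only [(hasDerivAt_pow_mul_rpow (hφ.differentiable (by norm_num)) n p (hφpos s hs)).deriv]
    obtain ⟨k, rfl⟩ : ∃ k, n = k + 3 := ⟨n - 3, by omega⟩
    simp only [show k + 3 - 1 = k + 2 by omega, show k + 3 - 2 = k + 1 by omega]
    have := hne s hs
    rcases eq_or_ne s 0 with rfl | hs0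
    · simp
    · field_simp
      ring

/-- With `A = ∫₀ʳ G' τ` and `I = G τ - A`, the ODE at a point says that `A² / G` and
`c ∫ G' L / Q` have the same derivative; here `Q = φ^(N-1)`. -/
theorem lichnerowicz_pointwise_iff {c L t Q G g A R : ℝ} (hQ : 0 < Q) (hG : 0 < G) (hg : 0 < g)
    (hR : R = Q / G ^ 2) :
    -c * L + t ^ 2 * Q = (G * t - A) ^ 2 * R ↔
      (2 * A * (g * t) * G - A ^ 2 * g) / G ^ 2 = c * (g / Q * L) := by
  subst hR
  rw [div_eq_iff (by positivity)]
  have e : (G * t - A) ^ 2 * (Q / G ^ 2) - (-c * L + t ^ 2 * Q) =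
      -(Q / (g * G ^ 2)) *
        ((2 * A * (g * t) * G - A ^ 2 * g) - c * (g / Q * L) * G ^ 2) := by
    field_simp
    ring
  have hne : -(Q / (g * G ^ 2)) ≠ 0 := neg_ne_zero.2 (by positivity)
  rw [eq_comm, ← sub_eq_zero, e, mul_eq_zero, or_iff_right hne, sub_eq_zero]

/-- The reduced Lichnerowicz ODE is, for positive nondecreasing
`φ`, equivalent to the integrated identity (3.8) of the paper. -/
theorem stmt3 (n : ℕ) (hn : 3 ≤ n) (φ τ : ℝ → ℝ)
    (hφreg : ContDiff ℝ 2 φ) (hφpos : ∀ r : ℝ, 0 ≤ r → 0 < φ r)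
    (hφ' : ∀ r : ℝ, 0 ≤ r → 0 ≤ deriv φ r)
    (hτreg : ContDiff ℝ 1 τ) :
    (∀ r > (0 : ℝ),
      -(4 * (n : ℝ) / ((n : ℝ) - 2)) * (deriv (deriv φ) r + ((n : ℝ) - 1) * deriv φ r / r)
          + (τ r) ^ 2 * φ r ^ (Nc n - 1)
        = (∫ s in (0 : ℝ)..r, s ^ n * φ s ^ (Nc n) * deriv τ s) ^ 2
            * φ r ^ (-(Nc n) - 1) / r ^ (2 * n))
    ↔
    (∀ r > (0 : ℝ),
      (∫ s in (0 : ℝ)..r, deriv (fun t : ℝ => t ^ n * φ t ^ (Nc n)) s * τ s) ^ 2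
        = 2 * Nc n * (r ^ n * φ r ^ (Nc n)) *
            ∫ s in (0 : ℝ)..r,
              (deriv (fun t : ℝ => t ^ n * φ t ^ (Nc n)) s / φ s ^ (Nc n - 1))
                * (deriv (deriv φ) s + ((n : ℝ) - 1) * deriv φ s / s)) := by
  have hn2 : (0 : ℝ) < (n : ℝ) - 2 := by
    have : (3 : ℝ) ≤ n := by exact_mod_cast hn
    linarith
  have hn0 : (0 : ℝ) < n := by linarith
  have hNpos : 0 < Nc n := by unfold Nc; positivity
  have hc : 4 * (n : ℝ) / ((n : ℝ) - 2) = 2 * Nc n := by unfold Nc; ring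
  have hφd : Differentiable ℝ φ := hφreg.differentiable (by norm_num)
  have hτc : Continuous τ := hτreg.continuous
  set G : ℝ → ℝ := fun t => t ^ n * φ t ^ Nc n with hGdef
  have hGd : ∀ s, 0 ≤ s → HasDerivAt G (deriv G s) s := fun s hs =>
    (hasDerivAt_pow_mul_rpow hφd n (Nc n) (hφpos s hs)).differentiableAt.hasDerivAt
  have hGpos : ∀ r > 0, 0 < G r := fun r hr =>
    mul_pos (pow_pos hr n) (rpow_pos_of_pos (hφpos r hr.le) _)
  have hG0 : G 0 = 0 := by simp [hGdef, show n ≠ 0 by omega]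
  have hgc : ContinuousOn (deriv G) (Set.Ici 0) :=
    continuousOn_deriv_pow_mul_rpow hφreg hφpos n (Nc n)
  have hgval : ∀ s, 0 ≤ s → deriv G s =
      n * s ^ (n - 1) * φ s ^ Nc n + s ^ n * (deriv φ s * Nc n * φ s ^ (Nc n - 1)) :=
    fun s hs => (hasDerivAt_pow_mul_rpow hφd n (Nc n) (hφpos s hs)).deriv
  have hgnonneg : ∀ s, 0 ≤ s → 0 ≤ deriv G s := fun s hs => by
    have := hφpos s hs
    have := hφ' s hs
    rw [hgval s hs]
    positivity
  have hgpos : ∀ s > 0, 0 < deriv G s := fun s hs => by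
    have := hφpos s hs.le
    have := hφ' s hs.le
    rw [hgval s hs.le]
    positivity
  have hgint : ∀ r > 0, IntervalIntegrable (deriv G) volume 0 r := fun r hr => by
    refine ContinuousOn.intervalIntegrable ?_
    rw [Set.uIcc_of_le (le_of_lt hr)]
    exact hgc.mono Set.Icc_subset_Ici_self
  have hGint : ∀ r > 0, ∫ s in (0 : ℝ)..r, deriv G s = G r := fun r hr => by
    rw [intervalIntegral.integral_eq_sub_of_hasDerivAt (fun s hs => hGd s ?_) (hgint r hr), hG0,
      sub_zero]
    rw [Set.uIcc_of_le (le_of_lt hr)] at hs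
    exact hs.1
  have hparts : ∀ r > 0, ∫ s in (0 : ℝ)..r, G s * deriv τ s =
      G r * τ r - ∫ s in (0 : ℝ)..r, deriv G s * τ s := fun r hr => by
    rw [intervalIntegral.integral_mul_deriv_eq_deriv_mul (fun s hs => hGd s ?_)
      (fun s _ => (hτreg.differentiable (by norm_num) s).hasDerivAt) (hgint r hr)
      ((hτreg.continuous_deriv le_rfl).intervalIntegrable 0 r), hG0, zero_mul, sub_zero]
    rw [Set.uIcc_of_le (le_of_lt hr)] at hs
    exact hs.1
  have hBc := continuousOn_deriv_mul_radial_laplacian hφreg hφpos hn (Nc n)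
  have key := forall_pos_eq_iff_forall_pos_deriv_eq
    (fun r hr => ((hasDerivAt_integral_of_continuousOn_Ici
      (hgc.mul hτc.continuousOn) hr).pow 2).div (hGd r (le_of_lt hr)) (hGpos r hr).ne')
    (fun r hr => (hasDerivAt_integral_of_continuousOn_Ici hBc hr).const_mul (2 * Nc n))
    (tendsto_sq_integral_mul_div hgc hgnonneg hGint hGpos hτc)
    (by simpa using (tendsto_integral_nhdsGT_zero hBc).const_mul (2 * Nc n))
  have hrhs : (∀ r > (0 : ℝ), (∫ s in (0 : ℝ)..r, deriv G s * τ s) ^ 2 / G r = 2 * Nc n *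
      ∫ s in (0 : ℝ)..r, (deriv G s / φ s ^ (Nc n - 1))
        * (deriv (deriv φ) s + ((n : ℝ) - 1) * deriv φ s / s)) ↔ _ := key
  have hmul : ∀ r > 0, ∀ a b : ℝ, a = 2 * Nc n * (r ^ n * φ r ^ Nc n) * b ↔
      a / G r = 2 * Nc n * b := fun r hr a b => by
    rw [div_eq_iff (hGpos r hr).ne']
    simp only [hGdef, mul_right_comm]
  refine Iff.trans ?_ ((forall₂_congr fun r hr => hmul r hr _ _).trans hrhs).symm
  refine forall₂_congr fun r hr => ?_
  have hφr := hφpos r (le_of_lt hr)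
  have hR : φ r ^ (-(Nc n) - 1) / r ^ (2 * n) = φ r ^ (Nc n - 1) / G r ^ 2 := by
    have hexp : φ r ^ (Nc n - 1) = φ r ^ (-(Nc n) - 1) * (φ r ^ Nc n) ^ 2 := by
      rw [← rpow_natCast, ← rpow_mul hφr.le, ← rpow_add hφr]
      congr 1
      push_cast
      ring
    have : φ r ^ Nc n ≠ 0 := (rpow_pos_of_pos hφr _).ne'
    simp only [hGdef]
    rw [hexp, pow_mul']
    field_simp
  have hpt := lichnerowicz_pointwise_iff (c := 2 * Nc n) (t := τ r)
    (L := deriv (deriv φ) r + ((n : ℝ) - 1) * deriv φ r / r)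
    (A := ∫ s in (0 : ℝ)..r, deriv G s * τ s)
    (rpow_pos_of_pos hφr (Nc n - 1)) (hGpos r hr) (hgpos r hr) hR
  rw [hc, show (∫ s in (0 : ℝ)..r, s ^ n * φ s ^ Nc n * deriv τ s) = _ from
    hparts r hr, mul_div_assoc ((_ : ℝ) ^ 2)]
  simpa using hpt
end
end

section
/- Let n ≥ 3 be an integer and N = 2n/(n−2). Let φ be a positive C² function on an interval [0, r₀]. Then for every r ∈ (0, r₀]: ∫₀^r ( (sⁿ φ(s)^N)'(s) / φ(s)^{N−1} ) ( φ''(s) + (n−1)φ'(s)/s ) ds = (n/2) r^{n−1} (φ²)'(r) + (N/2) rⁿ (φ'(r))², where (φ²)'(r) = 2φ(r)φ'(r). Equivalently, ∫₀^r ( n φ(s) + N s φ'(s) ) ( s^{n−1} φ'(s) )'(s) ds = n r^{n−1} φ(r) φ'(r) + (N/2) rⁿ (φ'(r))². -/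
open scoped BigOperators
open Real Filter MeasureTheory

noncomputable section

/-- The critical exponent satisfies `n + (N/2) n = N (n - 1)`. -/
lemma Nc_identity {n : ℕ} (hn : 3 ≤ n) :
    (n : ℝ) + Nc n / 2 * n = Nc n * ((n : ℝ) - 1) := by
  have h3 : (3 : ℝ) ≤ n := by exact_mod_cast hn
  have h : (n : ℝ) - 2 ≠ 0 := by linarith
  unfold Nc
  field_simp
  ring

/-- The product rule for the radial Laplacian in divergence form. -/
lemma hasDerivAt_pow_mul_deriv {n : ℕ} (hn : 1 ≤ n) {φ : ℝ → ℝ} {s : ℝ}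
    (h : DifferentiableAt ℝ (deriv φ) s) :
    HasDerivAt (fun t : ℝ => t ^ (n - 1) * deriv φ t)
      (s ^ (n - 1) * deriv (deriv φ) s + ((n : ℝ) - 1) * s ^ (n - 2) * deriv φ s) s := by
  refine ((hasDerivAt_pow (n - 1) s).mul h.hasDerivAt).congr_deriv ?_
  rw [Nat.cast_sub hn, Nat.cast_one, show n - 1 - 1 = n - 2 by lia]
  ring

/-- An explicit antiderivative of the integrand obtained by testing the radial Laplacian of `φ`
against `n φ` plus `N` times the dilation derivative of `φ`. -/
lemma hasDerivAt_pohozaev {n : ℕ} (hn : 3 ≤ n) {φ : ℝ → ℝ} {s : ℝ}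
    (h₁ : DifferentiableAt ℝ φ s) (h₂ : DifferentiableAt ℝ (deriv φ) s) :
    HasDerivAt
      (fun t : ℝ => (n : ℝ) * t ^ (n - 1) * φ t * deriv φ t + (Nc n / 2) * t ^ n * (deriv φ t) ^ 2)
      (((n : ℝ) * φ s + Nc n * s * deriv φ s)
        * (s ^ (n - 1) * deriv (deriv φ) s + ((n : ℝ) - 1) * s ^ (n - 2) * deriv φ s)) s := by
  have hd := (((hasDerivAt_pow_mul_deriv (by lia : 1 ≤ n) h₂).mul h₁.hasDerivAt).const_mul
    (n : ℝ)).add (((hasDerivAt_pow n s).mul (h₂.hasDerivAt.pow 2)).const_mul (Nc n / 2))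
  have key := Nc_identity hn
  refine (hd.congr_deriv ?_).congr_of_eventuallyEq (Eventually.of_forall fun t => ?_)
  · obtain ⟨m, rfl⟩ : ∃ m, n = m + 2 := ⟨n - 2, by lia⟩
    simp only [show m + 2 - 1 = m + 1 by lia, Nat.add_sub_cancel, Pi.pow_apply]
    push_cast at key ⊢
    linear_combination (s ^ (m + 1) * deriv φ s ^ 2) * key
  · simp only [Pi.add_apply, Pi.mul_apply, Pi.pow_apply]
    ring

/-- Differentiating `sⁿ φ^N` and dividing by `φ^{N-1}` turns the two integrands into each other. -/
lemma deriv_pow_mul_rpow_div_mul {n : ℕ} (hn : 2 ≤ n) (p : ℝ) {φ : ℝ → ℝ} {s : ℝ} (y : ℝ)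
    (hs : s ≠ 0) (hpos : 0 < φ s) (h : DifferentiableAt ℝ φ s) :
    (deriv (fun t : ℝ => t ^ n * φ t ^ p) s / φ s ^ (p - 1))
        * (y + ((n : ℝ) - 1) * deriv φ s / s)
      = ((n : ℝ) * φ s + p * s * deriv φ s)
        * (s ^ (n - 1) * y + ((n : ℝ) - 1) * s ^ (n - 2) * deriv φ s) := by
  have hd : HasDerivAt (fun t : ℝ => t ^ n * φ t ^ p) _ s :=
    (hasDerivAt_pow n s).mul (h.hasDerivAt.rpow_const (Or.inl hpos.ne'))
  have hp : φ s ^ p = φ s ^ (p - 1) * φ s := by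
    rw [← Real.rpow_add_one hpos.ne', sub_add_cancel]
  have hne : φ s ^ (p - 1) ≠ 0 := (Real.rpow_pos_of_pos hpos _).ne'
  rw [hd.deriv, hp]
  obtain ⟨m, rfl⟩ : ∃ m, n = m + 2 := ⟨n - 2, by lia⟩
  simp only [show m + 2 - 1 = m + 1 by lia, Nat.add_sub_cancel]
  field_simp
  ring

/-- The integration-by-parts identity (3.9) of the paper:
`∫₀^r ((sⁿφ^N)'/φ^{N−1})(φ'' + (n−1)φ'/s) ds = (n/2) r^{n−1}(φ²)' + (N/2) rⁿ(φ')²`,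
together with its equivalent form. -/
theorem stmt4 (n : ℕ) (hn : 3 ≤ n) (r₀ : ℝ) (hr₀ : 0 < r₀) (φ : ℝ → ℝ)
    (hφreg : ContDiff ℝ 2 φ) (hφpos : ∀ s ∈ Set.Icc (0 : ℝ) r₀, 0 < φ s) :
    ∀ r : ℝ, 0 < r → r ≤ r₀ →
      ((∫ s in (0 : ℝ)..r,
          (deriv (fun t : ℝ => t ^ n * φ t ^ (Nc n)) s / φ s ^ (Nc n - 1))
            * (deriv (deriv φ) s + ((n : ℝ) - 1) * deriv φ s / s))
        = ((n : ℝ) / 2) * r ^ (n - 1) * deriv (fun t : ℝ => φ t ^ 2) r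
            + (Nc n / 2) * r ^ n * (deriv φ r) ^ 2) ∧
      (deriv (fun t : ℝ => φ t ^ 2) r = 2 * φ r * deriv φ r) ∧
      ((∫ s in (0 : ℝ)..r,
          ((n : ℝ) * φ s + Nc n * s * deriv φ s)
            * deriv (fun t : ℝ => t ^ (n - 1) * deriv φ t) s)
        = (n : ℝ) * r ^ (n - 1) * φ r * deriv φ r
            + (Nc n / 2) * r ^ n * (deriv φ r) ^ 2) := by
  have hφ : Differentiable ℝ φ := hφreg.differentiable (by norm_num)
  have hφ' : ContDiff ℝ 1 (deriv φ) := hφreg.deriv'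
  have hdφ : Differentiable ℝ (deriv φ) := hφ'.differentiable (by norm_num)
  have hc : Continuous φ := hφ.continuous
  have hc' : Continuous (deriv φ) := hdφ.continuous
  have hc'' : Continuous (deriv (deriv φ)) := hφ'.continuous_deriv le_rfl
  intro r hr hrr₀
  have hsq : deriv (fun t : ℝ => φ t ^ 2) r = 2 * φ r * deriv φ r := by
    simpa using ((hφ r).hasDerivAt.fun_pow 2).deriv
  have hFTC := intervalIntegral.integral_eq_sub_of_hasDerivAt (a := 0) (b := r)
    (fun s _ => hasDerivAt_pohozaev hn (hφ s) (hdφ s))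
    (Continuous.intervalIntegrable (by fun_prop) _ _)
  simp only [zero_pow (by lia : n - 1 ≠ 0), zero_pow (by lia : n ≠ 0), mul_zero, zero_mul,
    add_zero, sub_zero] at hFTC
  refine ⟨?_, hsq, ?_⟩
  · rw [hsq, show (n : ℝ) / 2 * r ^ (n - 1) * (2 * φ r * deriv φ r)
      = n * r ^ (n - 1) * φ r * deriv φ r by ring, ← hFTC]
    refine intervalIntegral.integral_congr_ae (Eventually.of_forall fun s hs => ?_)
    rw [Set.uIoc_of_le hr.le] at hs
    exact deriv_pow_mul_rpow_div_mul (by lia) _ _ hs.1.ne'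
      (hφpos s ⟨hs.1.le, hs.2.trans hrr₀⟩) (hφ s)
  · rw [← hFTC]
    refine intervalIntegral.integral_congr fun s _ => ?_
    simp only [(hasDerivAt_pow_mul_deriv (by lia : 1 ≤ n) (hdφ s)).deriv]
end
end

section
/- Let n ≥ 3 be an integer and N = 2n/(n−2). Let φ: [0,∞) → ℝ be of class C¹ with φ(0) > 0. If φ'(r) ( 2n φ(r) + N r φ'(r) ) > 0 for almost every r > 0, then φ'(r) ≥ 0 for all r ≥ 0 (and consequently φ'(r) > 0 for almost every r > 0). Conversely, if φ > 0 on [0,∞) and φ'(r) > 0 for almost every r > 0, then φ'(r) ( 2n φ(r) + N r φ'(r) ) > 0 for almost every r > 0. -/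
open scoped BigOperators
open Real Filter MeasureTheory

noncomputable section

/-- If `f` and `g` are continuous and `f * g > 0` almost everywhere on `(0, ∞)`, then `f ≥ 0` at
every point of `(0, ∞)` where `g > 0`. -/
theorem nonneg_of_ae_mul_pos {f g : ℝ → ℝ} (hf : Continuous f) (hg : Continuous g)
    (h : ∀ᵐ r ∂(volume.restrict (Set.Ioi (0 : ℝ))), 0 < f r * g r)
    {r : ℝ} (hr : 0 < r) (hgr : 0 < g r) : 0 ≤ f r := by
  by_contra! hfr
  have hd : Dense {x : ℝ | x ∈ Set.Ioi (0 : ℝ) → 0 < f x * g x} :=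
    Measure.dense_of_ae ((ae_restrict_iff' measurableSet_Ioi).1 h)
  have hU : IsOpen {x : ℝ | 0 < x ∧ f x < 0 ∧ 0 < g x} :=
    (isOpen_lt continuous_const continuous_id).inter
      ((isOpen_lt hf continuous_const).inter (isOpen_lt continuous_const hg))
  obtain ⟨x, ⟨hx, hfx, hgx⟩, hpos⟩ := hd.inter_open_nonempty _ hU ⟨r, hr, hfr, hgr⟩
  exact absurd (hpos hx) (mul_neg_of_neg_of_pos hfx hgx).le.not_gt

/-- If `φ` is `C¹` with `φ 0 > 0` and `φ' (a φ + b r φ') > 0` almost everywhere on `(0, ∞)`, where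
`a > 0` and `b ≥ 0`, then `φ' ≥ 0` on `(0, ∞)`. -/
theorem deriv_nonneg_of_ae_mul_pos {a b : ℝ} (ha : 0 < a) (hb : 0 ≤ b) {φ : ℝ → ℝ}
    (hφ : ContDiff ℝ 1 φ) (hφ0 : 0 < φ 0)
    (h : ∀ᵐ r ∂(volume.restrict (Set.Ioi (0 : ℝ))),
      0 < deriv φ r * (a * φ r + b * r * deriv φ r)) {r : ℝ} (hr : 0 < r) :
    0 ≤ deriv φ r := by
  have hc : Continuous φ := hφ.continuous
  have hd : Continuous (deriv φ) := hφ.continuous_deriv le_rfl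
  have hg : Continuous fun r => a * φ r + b * r * deriv φ r := by fun_prop
  by_contra! hneg
  set S : Set ℝ := {x | 0 < x ∧ deriv φ x < 0}
  have hS : S.Nonempty := ⟨r, hr, hneg⟩
  have hbdd : BddBelow S := ⟨0, fun x hx => hx.1.le⟩
  set t := sInf S
  have ht : 0 ≤ t := le_csInf hS fun x hx => hx.1.le
  have hpos : ∀ x ∈ Set.Ioo 0 t, 0 ≤ deriv φ x := fun x hx => by
    by_contra! hx'
    exact (csInf_le hbdd ⟨hx.1, hx'⟩).not_gt hx.2
  have hmono : MonotoneOn φ (Set.Icc 0 t) :=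
    monotoneOn_of_deriv_nonneg (convex_Icc 0 t) hc.continuousOn
      (hφ.differentiable one_ne_zero).differentiableOn (by rwa [interior_Icc])
  have hφt : 0 < φ t :=
    hφ0.trans_le (hmono (Set.left_mem_Icc.2 ht) (Set.right_mem_Icc.2 ht) ht)
  have htd : 0 ≤ t * deriv φ t := by
    rcases ht.eq_or_lt with h0 | h0
    · simp [← h0]
    · have hmem : t ∈ closure (Set.Ioo 0 t) := by
        rw [closure_Ioo h0.ne]
        exact Set.right_mem_Icc.2 ht
      exact mul_nonneg ht
        (closure_minimal hpos (isClosed_le continuous_const hd) hmem)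
  have hgt : 0 < a * φ t + b * t * deriv φ t := by
    rw [mul_assoc]
    positivity
  obtain ⟨s, hgs, hs, hds⟩ := mem_closure_iff.1 (csInf_mem_closure hS hbdd)
    {x | 0 < a * φ x + b * x * deriv φ x} (isOpen_lt continuous_const hg) hgt
  exact hds.not_ge (nonneg_of_ae_mul_pos hd hg h hs hgs)

/-- Positivity of `φ'(2nφ + Nrφ')` a.e. forces `φ' ≥ 0`
everywhere on `[0,∞)` (and `φ' > 0` a.e.); conversely for positive `φ`,
`φ' > 0` a.e. gives back the positivity of the product a.e. -/
theorem stmt6 (n : ℕ) (hn : 3 ≤ n) (φ : ℝ → ℝ)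
    (hφreg : ContDiff ℝ 1 φ) (hφ0 : 0 < φ 0) :
    ((∀ᵐ r ∂(volume.restrict (Set.Ioi (0 : ℝ))),
        0 < deriv φ r * (2 * n * φ r + Nc n * r * deriv φ r)) →
      ((∀ r : ℝ, 0 ≤ r → 0 ≤ deriv φ r) ∧
        ∀ᵐ r ∂(volume.restrict (Set.Ioi (0 : ℝ))), 0 < deriv φ r))
    ∧
    ((∀ r : ℝ, 0 ≤ r → 0 < φ r) →
      (∀ᵐ r ∂(volume.restrict (Set.Ioi (0 : ℝ))), 0 < deriv φ r) →
      ∀ᵐ r ∂(volume.restrict (Set.Ioi (0 : ℝ))),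
        0 < deriv φ r * (2 * n * φ r + Nc n * r * deriv φ r)) := by
  have hn' : (0 : ℝ) < n := by positivity
  have hN : 0 ≤ Nc n := by
    have : (3 : ℝ) ≤ n := by exact_mod_cast hn
    exact div_nonneg (by positivity) (by linarith)
  refine ⟨fun h => ?_, fun hφ hd => ?_⟩
  · have hIoi : ∀ r ∈ Set.Ioi (0 : ℝ), 0 ≤ deriv φ r := fun r hr =>
      deriv_nonneg_of_ae_mul_pos (by positivity) hN hφreg hφ0 h hr
    refine ⟨fun r hr => ?_, ?_⟩
    · have hmem : r ∈ closure (Set.Ioi (0 : ℝ)) := by rwa [closure_Ioi]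
      exact closure_minimal hIoi
        (isClosed_le continuous_const (hφreg.continuous_deriv le_rfl)) hmem
    · filter_upwards [h, ae_restrict_mem measurableSet_Ioi] with r hr hr0
      exact (hIoi r hr0).lt_of_ne' (left_ne_zero_of_mul hr.ne')
  · filter_upwards [hd, ae_restrict_mem measurableSet_Ioi] with r hdr hr
    have hr0 : 0 < r := hr
    have hφr := hφ r hr0.le
    positivity
end
end

section
/- Let n ≥ 3 be an integer and N = 2n/(n−2). Let φ: [0,∞) → (0,∞) be of class C² with φ'(r) ≥ 0 for all r ≥ 0, and let τ: [0,∞) → ℝ satisfy, for every r > 0: |τ(r)| = √(2nN φ(r)^{1−N} φ''(r)) if φ'(r) = 0, and |τ(r)| = F[φ](r) if φ'(r) > 0. Then for every r₀ > 0 with φ'(r₀) = 0 one has φ''(r₀) = 0 and hence τ(r₀) = 0. Consequently, if τ(r) ≠ 0 for all r > 0, then φ'(r) > 0 for all r > 0. -/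
open scoped BigOperators
open Real Filter MeasureTheory

noncomputable section

/-- One-variable quantity
`F[φ](r) = 2 |(r^{2n−1} (φ^{(N+2)/2})')'| / ((N+2) r^{3n/2} φ^{N−1} √(φ'·(r^{n−2}φ)'))`. -/
def Ff (n : ℕ) (φ : ℝ → ℝ) (r : ℝ) : ℝ :=
  2 * |deriv (fun s : ℝ => s ^ (2 * n - 1) * deriv (fun t : ℝ => φ t ^ ((Nc n + 2) / 2)) s) r| /
    ((Nc n + 2) * r ^ ((3 * (n : ℝ)) / 2) * φ r ^ (Nc n - 1) *
      Real.sqrt (deriv φ r * deriv (fun s : ℝ => s ^ (n - 2) * φ s) r))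

/-- For a nondecreasing `φ` and `τ` given by the explicit
formula, `φ'(r₀) = 0` forces `φ''(r₀) = 0`, hence `τ(r₀) = 0`; so if `τ`
never vanishes on `(0,∞)` then `φ' > 0` on `(0,∞)`. -/
theorem stmt7 (n : ℕ) (hn : 3 ≤ n) (φ τ : ℝ → ℝ)
    (hφreg : ContDiff ℝ 2 φ)
    (hφpos : ∀ r : ℝ, 0 ≤ r → 0 < φ r)
    (hφ' : ∀ r : ℝ, 0 ≤ r → 0 ≤ deriv φ r)
    (hτ : ∀ r > (0 : ℝ),
      (deriv φ r = 0 →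
        |τ r| = Real.sqrt (2 * n * Nc n * φ r ^ (1 - Nc n) * deriv (deriv φ) r)) ∧
      (0 < deriv φ r → |τ r| = Ff n φ r)) :
    (∀ r₀ > (0 : ℝ), deriv φ r₀ = 0 → deriv (deriv φ) r₀ = 0 ∧ τ r₀ = 0) ∧
    ((∀ r > (0 : ℝ), τ r ≠ 0) → ∀ r > (0 : ℝ), 0 < deriv φ r) := by
  have key : ∀ r₀ > (0 : ℝ), deriv φ r₀ = 0 → deriv (deriv φ) r₀ = 0 ∧ τ r₀ = 0 := by
    intro r₀ hr₀ h
    have hmin : IsLocalMin (deriv φ) r₀ := by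
      filter_upwards [Ioi_mem_nhds hr₀] with r hr
      exact h.le.trans (hφ' r (le_of_lt hr))
    have h2 := hmin.deriv_eq_zero
    have hτ₀ := (hτ r₀ hr₀).1 h
    rw [h2, mul_zero, Real.sqrt_zero, abs_eq_zero] at hτ₀
    exact ⟨h2, hτ₀⟩
  exact ⟨key, fun hne r hr =>
    (hφ' r hr.le).lt_of_ne fun h => hne r hr (key r hr h.symm).2⟩
end
end
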